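/- arXiv:2408.05847 — 15 statements merged into one kernel-verified Lean document; each statement's English description precedes it below -/
import Mathlib

section
/- Fuzzy RD bias decomposition for the ATT (Theorem 2, first part, as established in its proof): Assume D^W ≠ 0. Then the one-sided limits μ₊ = lim_{r→c⁺} μ(r) and μ₋ = lim_{r→c⁻} μ(r) of the observed conditional mean exist, and with D^Y = μ₊ − μ₋, the fuzzy RD ratio satisfies D^Y / D^W = ATT(c) + (α₀·(1 − p₋) + α₁·p₋) / D^W. -/
open Filter Topology Set

/-- Fuzzy RD bias decomposition for the ATT: the one-sided limits of the observed
conditional mean exist and `D^Y / D^W = ATT(c) + (α₀(1 - p₋) + α₁ p₋)/D^W`. -/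
theorem fuzzy_rd_bias_att
    (c : ℝ) (μ0 μ1 p μ : ℝ → ℝ)
    (hμ : ∀ r, μ r = μ0 r + p r * (μ1 r - μ0 r))
    (μ0p μ0m μ1p μ1m pp pm : ℝ)
    (h0p : Tendsto μ0 (nhdsWithin c (Ioi c)) (nhds μ0p))
    (h0m : Tendsto μ0 (nhdsWithin c (Iio c)) (nhds μ0m))
    (h1p : Tendsto μ1 (nhdsWithin c (Ioi c)) (nhds μ1p))
    (h1m : Tendsto μ1 (nhdsWithin c (Iio c)) (nhds μ1m))
    (hpp : Tendsto p (nhdsWithin c (Ioi c)) (nhds pp))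
    (hpm : Tendsto p (nhdsWithin c (Iio c)) (nhds pm))
    (hDW : pp - pm ≠ 0) :
    ∃ μp μm : ℝ,
      Tendsto μ (nhdsWithin c (Ioi c)) (nhds μp) ∧
      Tendsto μ (nhdsWithin c (Iio c)) (nhds μm) ∧
      (μp - μm) / (pp - pm) =
        (μ1p - μ0p) +
          ((μ0p - μ0m) * (1 - pm) + (μ1p - μ1m) * pm) / (pp - pm) := by
  obtain rfl : μ = fun r => μ0 r + p r * (μ1 r - μ0 r) := funext hμ
  refine ⟨μ0p + pp * (μ1p - μ0p), μ0m + pm * (μ1m - μ0m),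
    h0p.add (hpp.mul (h1p.sub h0p)), h0m.add (hpm.mul (h1m.sub h0m)), ?_⟩
  field_simp
  ring
end

section
/- Fuzzy RD bias decomposition for the ATU (Theorem 2, second part, as established in its proof): Assume D^W ≠ 0. Then the one-sided limits μ₊ = lim_{r→c⁺} μ(r) and μ₋ = lim_{r→c⁻} μ(r) of the observed conditional mean exist, and with D^Y = μ₊ − μ₋, the fuzzy RD ratio satisfies D^Y / D^W = ATU(c) + (α₀·(1 − p₊) + α₁·p₊) / D^W. -/
open Filter Topology Set

/-- Fuzzy RD bias decomposition for the ATU: the one-sided limits of the observed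
conditional mean exist and `D^Y / D^W = ATU(c) + (α₀(1 - p₊) + α₁ p₊)/D^W`. -/
theorem fuzzy_rd_bias_atu
    (c : ℝ) (μ0 μ1 p μ : ℝ → ℝ)
    (hμ : ∀ r, μ r = μ0 r + p r * (μ1 r - μ0 r))
    (μ0p μ0m μ1p μ1m pp pm : ℝ)
    (h0p : Tendsto μ0 (nhdsWithin c (Ioi c)) (nhds μ0p))
    (h0m : Tendsto μ0 (nhdsWithin c (Iio c)) (nhds μ0m))
    (h1p : Tendsto μ1 (nhdsWithin c (Ioi c)) (nhds μ1p))
    (h1m : Tendsto μ1 (nhdsWithin c (Iio c)) (nhds μ1m))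
    (hpp : Tendsto p (nhdsWithin c (Ioi c)) (nhds pp))
    (hpm : Tendsto p (nhdsWithin c (Iio c)) (nhds pm))
    (hDW : pp - pm ≠ 0) :
    ∃ μp μm : ℝ,
      Tendsto μ (nhdsWithin c (Ioi c)) (nhds μp) ∧
      Tendsto μ (nhdsWithin c (Iio c)) (nhds μm) ∧
      (μp - μm) / (pp - pm) =
        (μ1m - μ0m) +
          ((μ0p - μ0m) * (1 - pp) + (μ1p - μ1m) * pp) / (pp - pm) := by
  obtain rfl : μ = fun r => μ0 r + p r * (μ1 r - μ0 r) := funext hμ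
  refine ⟨_, _, h0p.add (hpp.mul (h1p.sub h0p)), h0m.add (hpm.mul (h1m.sub h0m)), ?_⟩
  field_simp
  ring
end

section
/- Fuzzy RD discontinuity decomposition, ATU form (intermediate identity in the proof of Theorem 2): The one-sided limits μ₊, μ₋ of the observed conditional mean μ at c exist and the observed outcome discontinuity D^Y = μ₊ − μ₋ satisfies D^Y = (1 − p₊)·α₀ + p₊·α₁ + D^W·ATU(c). -/
open Filter Topology Set

/-- Fuzzy RD discontinuity decomposition, ATU form:
`D^Y = (1 - p₊)·α₀ + p₊·α₁ + D^W·ATU(c)`. -/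
theorem fuzzy_rd_decomposition_atu
    (c : ℝ) (μ0 μ1 p μ : ℝ → ℝ)
    (hμ : ∀ r, μ r = μ0 r + p r * (μ1 r - μ0 r))
    (μ0p μ0m μ1p μ1m pp pm : ℝ)
    (h0p : Tendsto μ0 (nhdsWithin c (Ioi c)) (nhds μ0p))
    (h0m : Tendsto μ0 (nhdsWithin c (Iio c)) (nhds μ0m))
    (h1p : Tendsto μ1 (nhdsWithin c (Ioi c)) (nhds μ1p))
    (h1m : Tendsto μ1 (nhdsWithin c (Iio c)) (nhds μ1m))
    (hpp : Tendsto p (nhdsWithin c (Ioi c)) (nhds pp))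
    (hpm : Tendsto p (nhdsWithin c (Iio c)) (nhds pm)) :
    ∃ μp μm : ℝ,
      Tendsto μ (nhdsWithin c (Ioi c)) (nhds μp) ∧
      Tendsto μ (nhdsWithin c (Iio c)) (nhds μm) ∧
      μp - μm =
        (1 - pp) * (μ0p - μ0m) + pp * (μ1p - μ1m) + (pp - pm) * (μ1m - μ0m) := by
  obtain rfl : μ = fun r => μ0 r + p r * (μ1 r - μ0 r) := funext hμ
  exact ⟨_, _, h0p.add (hpp.mul (h1p.sub h0p)), h0m.add (hpm.mul (h1m.sub h0m)), by ring⟩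
end

section
/- RD-DID identification of the ATT (Theorem 3(i)): Assume the one-sided limits μ_{0,t,±} at c exist for every t ∈ 𝒯₀ ∪ {t*} and the one-sided limits μ_{1,t*,±} exist. Suppose 𝒯₀ is nonempty and there is a function g₀ : (𝒯₀ → ℝ) → ℝ with α_{0,t*} = g₀(fun t ↦ α_{0,t}). Then the one-sided limits defining D_t exist for all t ∈ 𝒯₀ ∪ {t*}, D_t = α_{0,t} for every t ∈ 𝒯₀, and ATT(c,t*) = D_{t*} − g₀(fun t ↦ D_t). -/
open Filter Topology Set

/-- RD-DID identification of the ATT (Theorem 3(i)). `T0` is the set of periods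
where every unit is untreated (so the observed mean `μ t` equals `μ0 t` there),
`tstar` is the sharp RD period. Under existence of one-sided limits and the
learnability assumption `α₀,t* = g₀(α₀,·)`, the observed discontinuities `D_t`
exist, coincide with `α₀,t` on `T0`, and `ATT(c,t*) = D_{t*} - g₀(D_·)`. -/
theorem rddid_att
    {T : Type*} (c : ℝ) (tstar : T) (T0 : Set T) (htstar : tstar ∉ T0)
    (hT0 : T0.Nonempty)
    (μ0 μ1 μ : T → ℝ → ℝ)
    (hobs0 : ∀ t ∈ T0, ∀ r, μ t r = μ0 t r)
    (hobsstar : ∀ r, μ tstar r = if c ≤ r then μ1 tstar r else μ0 tstar r)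
    (μ0p μ0m : T → ℝ)
    (h0p : ∀ t ∈ insert tstar T0,
      Tendsto (μ0 t) (nhdsWithin c (Ioi c)) (nhds (μ0p t)))
    (h0m : ∀ t ∈ insert tstar T0,
      Tendsto (μ0 t) (nhdsWithin c (Iio c)) (nhds (μ0m t)))
    (μ1p μ1m : ℝ)
    (h1p : Tendsto (μ1 tstar) (nhdsWithin c (Ioi c)) (nhds μ1p))
    (h1m : Tendsto (μ1 tstar) (nhdsWithin c (Iio c)) (nhds μ1m))
    (g0 : (T0 → ℝ) → ℝ)
    (hg0 : μ0p tstar - μ0m tstar = g0 (fun t => μ0p t.1 - μ0m t.1)) :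
    ∃ Dp Dm : T → ℝ,
      (∀ t ∈ insert tstar T0,
        Tendsto (μ t) (nhdsWithin c (Ioi c)) (nhds (Dp t)) ∧
        Tendsto (μ t) (nhdsWithin c (Iio c)) (nhds (Dm t))) ∧
      (∀ t ∈ T0, Dp t - Dm t = μ0p t - μ0m t) ∧
      μ1p - μ0p tstar = (Dp tstar - Dm tstar) - g0 (fun t => Dp t.1 - Dm t.1) := by
  classical
  have hne : ∀ t ∈ T0, t ≠ tstar := fun t ht h => htstar (h ▸ ht)
  have hDp : ∀ t ∈ T0, Function.update μ0p tstar μ1p t = μ0p t := fun t ht =>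
    Function.update_of_ne (hne t ht) _ _
  refine ⟨Function.update μ0p tstar μ1p, μ0m, ?_, fun t ht => by rw [hDp t ht], ?_⟩
  · rintro t (rfl | ht)
    · refine ⟨?_, ?_⟩
      · rw [Function.update_self]
        refine h1p.congr' ?_
        filter_upwards [self_mem_nhdsWithin] with r hr
        rw [hobsstar, if_pos (le_of_lt hr)]
      · refine (h0m t (mem_insert t T0)).congr' ?_
        filter_upwards [self_mem_nhdsWithin] with r hr
        rw [hobsstar, if_neg (not_le_of_gt hr)]
    · rw [hDp t ht, funext (hobs0 t ht)]
      exact ⟨h0p t (mem_insert_of_mem _ ht), h0m t (mem_insert_of_mem _ ht)⟩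
  · have hD : (fun t : T0 => Function.update μ0p tstar μ1p t.1 - μ0m t.1) =
        fun t : T0 => μ0p t.1 - μ0m t.1 :=
      funext fun t => by rw [hDp t.1 t.2]
    rw [hD, ← hg0, Function.update_self]
    ring
end

section
/- RD-DID identification of the ATU (Theorem 3(ii)): Assume the one-sided limits μ_{1,t,±} at c exist for every t ∈ 𝒯₁ ∪ {t*} and the one-sided limits μ_{0,t*,±} exist. Suppose 𝒯₁ is nonempty and there is a function g₁ : (𝒯₁ → ℝ) → ℝ with α_{1,t*} = g₁(fun t ↦ α_{1,t}). Then the one-sided limits defining D_t exist for all t ∈ 𝒯₁ ∪ {t*}, D_t = α_{1,t} for every t ∈ 𝒯₁, and ATU(c,t*) = D_{t*} − g₁(fun t ↦ D_t). -/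
open Filter Topology Set

/-- RD-DID identification of the ATU (Theorem 3(ii)). `T1` is the set of periods
where every unit is treated (so the observed mean `μ t` equals `μ1 t` there),
`tstar` is the sharp RD period. Under existence of one-sided limits and the
learnability assumption `α₁,t* = g₁(α₁,·)`, the observed discontinuities `D_t`
exist, coincide with `α₁,t` on `T1`, and `ATU(c,t*) = D_{t*} - g₁(D_·)`. -/
theorem rddid_atu
    {T : Type*} (c : ℝ) (tstar : T) (T1 : Set T) (htstar : tstar ∉ T1)
    (hT1 : T1.Nonempty)
    (μ0 μ1 μ : T → ℝ → ℝ)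
    (hobs1 : ∀ t ∈ T1, ∀ r, μ t r = μ1 t r)
    (hobsstar : ∀ r, μ tstar r = if c ≤ r then μ1 tstar r else μ0 tstar r)
    (μ1p μ1m : T → ℝ)
    (h1p : ∀ t ∈ insert tstar T1,
      Tendsto (μ1 t) (nhdsWithin c (Ioi c)) (nhds (μ1p t)))
    (h1m : ∀ t ∈ insert tstar T1,
      Tendsto (μ1 t) (nhdsWithin c (Iio c)) (nhds (μ1m t)))
    (μ0p μ0m : ℝ)
    (h0p : Tendsto (μ0 tstar) (nhdsWithin c (Ioi c)) (nhds μ0p))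
    (h0m : Tendsto (μ0 tstar) (nhdsWithin c (Iio c)) (nhds μ0m))
    (g1 : (T1 → ℝ) → ℝ)
    (hg1 : μ1p tstar - μ1m tstar = g1 (fun t => μ1p t.1 - μ1m t.1)) :
    ∃ Dp Dm : T → ℝ,
      (∀ t ∈ insert tstar T1,
        Tendsto (μ t) (nhdsWithin c (Ioi c)) (nhds (Dp t)) ∧
        Tendsto (μ t) (nhdsWithin c (Iio c)) (nhds (Dm t))) ∧
      (∀ t ∈ T1, Dp t - Dm t = μ1p t - μ1m t) ∧
      μ1m tstar - μ0m = (Dp tstar - Dm tstar) - g1 (fun t => Dp t.1 - Dm t.1) := by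
  classical
  have hne : ∀ t ∈ T1, t ≠ tstar := fun t ht h => htstar (h ▸ ht)
  have hjump : ∀ t ∈ T1, μ1p t - Function.update μ1m tstar μ0m t = μ1p t - μ1m t :=
    fun t ht => by rw [Function.update_of_ne (hne t ht)]
  refine ⟨μ1p, Function.update μ1m tstar μ0m, ?_, hjump, ?_⟩
  · rintro t (rfl | ht)
    · rw [Function.update_self]
      refine ⟨(h1p t (mem_insert t T1)).congr' ?_, h0m.congr' ?_⟩
      · filter_upwards [self_mem_nhdsWithin] with r hr
        rw [hobsstar, if_pos (le_of_lt hr)]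
      · filter_upwards [self_mem_nhdsWithin] with r hr
        rw [hobsstar, if_neg (not_le_of_gt hr)]
    · rw [Function.update_of_ne (hne t ht), funext (hobs1 t ht)]
      exact ⟨h1p t (mem_insert_of_mem tstar ht), h1m t (mem_insert_of_mem tstar ht)⟩
  · rw [funext fun t : T1 => hjump t.1 t.2, ← hg1, Function.update_self]
    ring
end

section
/- RD-DID with constant discontinuities, ATT (Corollary 1(i), first part): Assume the one-sided limits μ_{0,t,±} at c exist for every t ∈ 𝒯₀ ∪ {t*} and μ_{1,t*,±} exist. Suppose 𝒯₀ is a nonempty finite set, π : 𝒯₀ → ℝ are weights with ∑_{t∈𝒯₀} π_t = 1, and α_{0,t} = α_{0,t*} for every t ∈ 𝒯₀ (constant untreated discontinuity across 𝒯₀ ∪ {t*}). Then ATT(c,t*) = D_{t*} − ∑_{t∈𝒯₀} π_t · D_t. -/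
open Filter Topology Set

/-- RD-DID with constant discontinuities, ATT (Corollary 1(i), first part): if the
untreated discontinuity is constant across `T0 ∪ {t*}` and the weights `π` sum to
one over the nonempty finite set `T0`, then
`ATT(c,t*) = D_{t*} - ∑_{t ∈ T0} π t * D t`, where `D_t = Dp t - Dm t` is the
discontinuity of the observed conditional mean `μ t` at `c`. -/
theorem rddid_const_att
    {T : Type*} [DecidableEq T]
    (c : ℝ) (tstar : T) (T0 : Finset T) (htstar : tstar ∉ T0)
    (hT0 : T0.Nonempty)
    (μ0 μ1 μ : T → ℝ → ℝ)
    (hobs0 : ∀ t ∈ T0, ∀ r, μ t r = μ0 t r)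
    (hobsstar : ∀ r, μ tstar r = if c ≤ r then μ1 tstar r else μ0 tstar r)
    (μ0p μ0m : T → ℝ)
    (h0p : ∀ t ∈ insert tstar T0,
      Tendsto (μ0 t) (nhdsWithin c (Ioi c)) (nhds (μ0p t)))
    (h0m : ∀ t ∈ insert tstar T0,
      Tendsto (μ0 t) (nhdsWithin c (Iio c)) (nhds (μ0m t)))
    (μ1p μ1m : ℝ)
    (h1p : Tendsto (μ1 tstar) (nhdsWithin c (Ioi c)) (nhds μ1p))
    (h1m : Tendsto (μ1 tstar) (nhdsWithin c (Iio c)) (nhds μ1m))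
    (π : T → ℝ) (hπ : ∑ t ∈ T0, π t = 1)
    (hconst : ∀ t ∈ T0, μ0p t - μ0m t = μ0p tstar - μ0m tstar)
    (Dp Dm : T → ℝ)
    (hDp : ∀ t ∈ insert tstar T0,
      Tendsto (μ t) (nhdsWithin c (Ioi c)) (nhds (Dp t)))
    (hDm : ∀ t ∈ insert tstar T0,
      Tendsto (μ t) (nhdsWithin c (Iio c)) (nhds (Dm t))) :
    μ1p - μ0p tstar = (Dp tstar - Dm tstar) - ∑ t ∈ T0, π t * (Dp t - Dm t) := by
  have hstar := Finset.mem_insert_self tstar T0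
  have hDp_star : Dp tstar = μ1p := by
    refine tendsto_nhds_unique (hDp tstar hstar) (h1p.congr' ?_)
    filter_upwards [self_mem_nhdsWithin] with r hr
    rw [hobsstar, if_pos (le_of_lt hr)]
  have hDm_star : Dm tstar = μ0m tstar := by
    refine tendsto_nhds_unique (hDm tstar hstar) ((h0m tstar hstar).congr' ?_)
    filter_upwards [self_mem_nhdsWithin] with r hr
    rw [hobsstar, if_neg (not_le_of_gt hr)]
  have hD : ∀ t ∈ T0, Dp t - Dm t = μ0p tstar - μ0m tstar := by
    intro t ht
    have hmem := Finset.mem_insert_of_mem (b := tstar) ht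
    have hμ : μ t = μ0 t := funext (hobs0 t ht)
    have hp : Dp t = μ0p t := tendsto_nhds_unique (hDp t hmem) (hμ ▸ h0p t hmem)
    have hm : Dm t = μ0m t := tendsto_nhds_unique (hDm t hmem) (hμ ▸ h0m t hmem)
    rw [hp, hm, hconst t ht]
  have hsum : ∑ t ∈ T0, π t * (Dp t - Dm t) = μ0p tstar - μ0m tstar := by
    rw [Finset.sum_congr rfl fun t ht => by rw [hD t ht], ← Finset.sum_mul, hπ, one_mul]
  rw [hsum, hDp_star, hDm_star]
  ring
end

section
/- RD-DID with constant discontinuities, ATU (Corollary 1(i), second part): Assume the one-sided limits μ_{1,t,±} at c exist for every t ∈ 𝒯₁ ∪ {t*} and μ_{0,t*,±} exist. Suppose 𝒯₁ is a nonempty finite set, π : 𝒯₁ → ℝ are weights with ∑_{t∈𝒯₁} π_t = 1, and α_{1,t} = α_{1,t*} for every t ∈ 𝒯₁ (constant treated discontinuity across 𝒯₁ ∪ {t*}). Then ATU(c,t*) = D_{t*} − ∑_{t∈𝒯₁} π_t · D_t. -/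
open Filter Topology Set

/-- RD-DID with constant discontinuities, ATU (Corollary 1(i), second part): if the
treated discontinuity is constant across `T1 ∪ {t*}` and the weights `π` sum to one
over the nonempty finite set `T1`, then
`ATU(c,t*) = D_{t*} - ∑_{t ∈ T1} π t * D t`, where `D_t = Dp t - Dm t` is the
discontinuity of the observed conditional mean `μ t` at `c`. -/
theorem rddid_const_atu
    {T : Type*} [DecidableEq T]
    (c : ℝ) (tstar : T) (T1 : Finset T) (htstar : tstar ∉ T1)
    (hT1 : T1.Nonempty)
    (μ0 μ1 μ : T → ℝ → ℝ)
    (hobs1 : ∀ t ∈ T1, ∀ r, μ t r = μ1 t r)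
    (hobsstar : ∀ r, μ tstar r = if c ≤ r then μ1 tstar r else μ0 tstar r)
    (μ1p μ1m : T → ℝ)
    (h1p : ∀ t ∈ insert tstar T1,
      Tendsto (μ1 t) (nhdsWithin c (Ioi c)) (nhds (μ1p t)))
    (h1m : ∀ t ∈ insert tstar T1,
      Tendsto (μ1 t) (nhdsWithin c (Iio c)) (nhds (μ1m t)))
    (μ0p μ0m : ℝ)
    (h0p : Tendsto (μ0 tstar) (nhdsWithin c (Ioi c)) (nhds μ0p))
    (h0m : Tendsto (μ0 tstar) (nhdsWithin c (Iio c)) (nhds μ0m))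
    (π : T → ℝ) (hπ : ∑ t ∈ T1, π t = 1)
    (hconst : ∀ t ∈ T1, μ1p t - μ1m t = μ1p tstar - μ1m tstar)
    (Dp Dm : T → ℝ)
    (hDp : ∀ t ∈ insert tstar T1,
      Tendsto (μ t) (nhdsWithin c (Ioi c)) (nhds (Dp t)))
    (hDm : ∀ t ∈ insert tstar T1,
      Tendsto (μ t) (nhdsWithin c (Iio c)) (nhds (Dm t))) :
    μ1m tstar - μ0m = (Dp tstar - Dm tstar) - ∑ t ∈ T1, π t * (Dp t - Dm t) := by
  have hDp_star : Dp tstar = μ1p tstar := by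
    refine tendsto_nhds_unique (hDp tstar (Finset.mem_insert_self _ _))
      ((h1p tstar (Finset.mem_insert_self _ _)).congr' ?_)
    filter_upwards [self_mem_nhdsWithin] with r hr
    rw [hobsstar, if_pos (le_of_lt hr)]
  have hDm_star : Dm tstar = μ0m := by
    refine tendsto_nhds_unique (hDm tstar (Finset.mem_insert_self _ _)) (h0m.congr' ?_)
    filter_upwards [self_mem_nhdsWithin] with r hr
    rw [hobsstar, if_neg (not_le_of_gt hr)]
  have hD : ∀ t ∈ T1, Dp t - Dm t = μ1p tstar - μ1m tstar := by
    intro t ht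
    have hmem := Finset.mem_insert_of_mem (b := tstar) ht
    have hμ : μ t = μ1 t := funext (hobs1 t ht)
    have hp : Dp t = μ1p t := tendsto_nhds_unique (hDp t hmem) (hμ ▸ h1p t hmem)
    have hm : Dm t = μ1m t := tendsto_nhds_unique (hDm t hmem) (hμ ▸ h1m t hmem)
    rw [hp, hm, hconst t ht]
  have hsum : ∑ t ∈ T1, π t * (Dp t - Dm t) = μ1p tstar - μ1m tstar := by
    rw [Finset.sum_congr rfl fun t ht => by rw [hD t ht], ← Finset.sum_mul, hπ, one_mul]
  rw [hsum, hDp_star, hDm_star]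
  ring
end

section
/- RD-DID with linear-in-time discontinuities, ATT (Corollary 1(ii), first part): Take the time index to be real, T = ℝ. Assume the one-sided limits μ_{0,t,±} at c exist for every t ∈ 𝒯₀ ∪ {t*} and μ_{1,t*,±} exist. Suppose there exist m₀, β₀ ∈ ℝ such that α_{0,t} = m₀·t + β₀ for every t ∈ 𝒯₀ ∪ {t*}. Then for every t₀ ∈ 𝒯₀, ATT(c,t*) = D_{t*} − (m₀·(t* − t₀) + D_{t₀}). -/
open Filter Topology Set

/-- RD-DID with linear-in-time discontinuities, ATT (Corollary 1(ii), first part),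
with real time index: if `α₀,t = m₀·t + β₀` for all `t ∈ T0 ∪ {t*}`, then for every
`t₀ ∈ T0`, `ATT(c,t*) = D_{t*} - (m₀·(t* - t₀) + D_{t₀})`, where `D_t = Dp t - Dm t`
is the discontinuity of the observed conditional mean `μ t` at `c`. -/
theorem rddid_linear_att
    (c : ℝ) (tstar : ℝ) (T0 : Set ℝ) (htstar : tstar ∉ T0)
    (μ0 μ1 μ : ℝ → ℝ → ℝ)
    (hobs0 : ∀ t ∈ T0, ∀ r, μ t r = μ0 t r)
    (hobsstar : ∀ r, μ tstar r = if c ≤ r then μ1 tstar r else μ0 tstar r)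
    (μ0p μ0m : ℝ → ℝ)
    (h0p : ∀ t ∈ insert tstar T0,
      Tendsto (μ0 t) (nhdsWithin c (Ioi c)) (nhds (μ0p t)))
    (h0m : ∀ t ∈ insert tstar T0,
      Tendsto (μ0 t) (nhdsWithin c (Iio c)) (nhds (μ0m t)))
    (μ1p μ1m : ℝ)
    (h1p : Tendsto (μ1 tstar) (nhdsWithin c (Ioi c)) (nhds μ1p))
    (h1m : Tendsto (μ1 tstar) (nhdsWithin c (Iio c)) (nhds μ1m))
    (m0 β0 : ℝ)
    (hlin : ∀ t ∈ insert tstar T0, μ0p t - μ0m t = m0 * t + β0)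
    (Dp Dm : ℝ → ℝ)
    (hDp : ∀ t ∈ insert tstar T0,
      Tendsto (μ t) (nhdsWithin c (Ioi c)) (nhds (Dp t)))
    (hDm : ∀ t ∈ insert tstar T0,
      Tendsto (μ t) (nhdsWithin c (Iio c)) (nhds (Dm t))) :
    ∀ t0 ∈ T0,
      μ1p - μ0p tstar =
        (Dp tstar - Dm tstar) - (m0 * (tstar - t0) + (Dp t0 - Dm t0)) := by
  intro t0 ht0
  have hs : tstar ∈ insert tstar T0 := mem_insert _ _
  have h0 : t0 ∈ insert tstar T0 := mem_insert_of_mem _ ht0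
  have hμ : μ t0 = μ0 t0 := funext (hobs0 t0 ht0)
  have hright : μ1 tstar =ᶠ[𝓝[>] c] μ tstar := by
    filter_upwards [self_mem_nhdsWithin] with r hr
    rw [hobsstar, if_pos (le_of_lt hr)]
  have hleft : μ0 tstar =ᶠ[𝓝[<] c] μ tstar := by
    filter_upwards [self_mem_nhdsWithin] with r hr
    rw [hobsstar, if_neg (not_le_of_gt hr)]
  have hDps : Dp tstar = μ1p := tendsto_nhds_unique (hDp tstar hs) (h1p.congr' hright)
  have hDms : Dm tstar = μ0m tstar :=
    tendsto_nhds_unique (hDm tstar hs) ((h0m tstar hs).congr' hleft)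
  have hDp0 : Dp t0 = μ0p t0 := tendsto_nhds_unique (hμ ▸ hDp t0 h0) (h0p t0 h0)
  have hDm0 : Dm t0 = μ0m t0 := tendsto_nhds_unique (hμ ▸ hDm t0 h0) (h0m t0 h0)
  rw [hDps, hDms, hDp0, hDm0]
  linear_combination hlin t0 h0 - hlin tstar hs
end

section
/- RD-DID with linear-in-time discontinuities, ATU (Corollary 1(ii), second part): Take the time index to be real, T = ℝ. Assume the one-sided limits μ_{1,t,±} at c exist for every t ∈ 𝒯₁ ∪ {t*} and μ_{0,t*,±} exist. Suppose there exist m₁, β₁ ∈ ℝ such that α_{1,t} = m₁·t + β₁ for every t ∈ 𝒯₁ ∪ {t*}. Then for every t₁ ∈ 𝒯₁, ATU(c,t*) = D_{t*} − (m₁·(t* − t₁) + D_{t₁}). -/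
open Filter Topology Set

/-- RD-DID with linear-in-time discontinuities, ATU (Corollary 1(ii), second part),
with real time index: if `α₁,t = m₁·t + β₁` for all `t ∈ T1 ∪ {t*}`, then for every
`t₁ ∈ T1`, `ATU(c,t*) = D_{t*} - (m₁·(t* - t₁) + D_{t₁})`, where `D_t = Dp t - Dm t`
is the discontinuity of the observed conditional mean `μ t` at `c`. -/
theorem rddid_linear_atu
    (c : ℝ) (tstar : ℝ) (T1 : Set ℝ) (htstar : tstar ∉ T1)
    (μ0 μ1 μ : ℝ → ℝ → ℝ)
    (hobs1 : ∀ t ∈ T1, ∀ r, μ t r = μ1 t r)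
    (hobsstar : ∀ r, μ tstar r = if c ≤ r then μ1 tstar r else μ0 tstar r)
    (μ1p μ1m : ℝ → ℝ)
    (h1p : ∀ t ∈ insert tstar T1,
      Tendsto (μ1 t) (nhdsWithin c (Ioi c)) (nhds (μ1p t)))
    (h1m : ∀ t ∈ insert tstar T1,
      Tendsto (μ1 t) (nhdsWithin c (Iio c)) (nhds (μ1m t)))
    (μ0p μ0m : ℝ)
    (h0p : Tendsto (μ0 tstar) (nhdsWithin c (Ioi c)) (nhds μ0p))
    (h0m : Tendsto (μ0 tstar) (nhdsWithin c (Iio c)) (nhds μ0m))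
    (m1 β1 : ℝ)
    (hlin : ∀ t ∈ insert tstar T1, μ1p t - μ1m t = m1 * t + β1)
    (Dp Dm : ℝ → ℝ)
    (hDp : ∀ t ∈ insert tstar T1,
      Tendsto (μ t) (nhdsWithin c (Ioi c)) (nhds (Dp t)))
    (hDm : ∀ t ∈ insert tstar T1,
      Tendsto (μ t) (nhdsWithin c (Iio c)) (nhds (Dm t))) :
    ∀ t1 ∈ T1,
      μ1m tstar - μ0m =
        (Dp tstar - Dm tstar) - (m1 * (tstar - t1) + (Dp t1 - Dm t1)) := by
  intro t1 ht1
  have hs : tstar ∈ insert tstar T1 := mem_insert _ _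
  have ht : t1 ∈ insert tstar T1 := mem_insert_of_mem _ ht1
  have hμ : μ t1 = μ1 t1 := funext (hobs1 t1 ht1)
  have hp : Dp t1 = μ1p t1 := tendsto_nhds_unique (hDp t1 ht) (hμ ▸ h1p t1 ht)
  have hm : Dm t1 = μ1m t1 := tendsto_nhds_unique (hDm t1 ht) (hμ ▸ h1m t1 ht)
  have hright : μ tstar =ᶠ[𝓝[>] c] μ1 tstar := by
    filter_upwards [self_mem_nhdsWithin] with r hr
    rw [hobsstar, if_pos (le_of_lt hr)]
  have hleft : μ tstar =ᶠ[𝓝[<] c] μ0 tstar := by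
    filter_upwards [self_mem_nhdsWithin] with r hr
    rw [hobsstar, if_neg (not_le_of_gt hr)]
  have hsp : Dp tstar = μ1p tstar :=
    tendsto_nhds_unique (hDp tstar hs) ((h1p tstar hs).congr' hright.symm)
  have hsm : Dm tstar = μ0m :=
    tendsto_nhds_unique (hDm tstar hs) (h0m.congr' hleft.symm)
  rw [hp, hm, hsp, hsm]
  linarith [hlin tstar hs, hlin t1 ht]
end

section
/- Fuzzy RD-DID identification of the ATT (Theorem 4, first part): Assume the one-sided limits μ_{0,t,±} exist for all t ∈ 𝒯₀ ∪ {t*}, the one-sided limits μ_{1,t,±} exist for all t ∈ 𝒯₁ ∪ {t*}, and p₊ = lim_{r→c⁺} p_{t*}(r), p₋ = lim_{r→c⁻} p_{t*}(r) exist with D^W = p₊ − p₋ ≠ 0. Suppose 𝒯₀ and 𝒯₁ are nonempty and there are functions g₀ : (𝒯₀ → ℝ) → ℝ and g₁ : (𝒯₁ → ℝ) → ℝ with α_{0,t*} = g₀(fun t ↦ α_{0,t}) and α_{1,t*} = g₁(fun t ↦ α_{1,t}). Then the one-sided limits defining D_{t*} exist, and ATT(c,t*) = D_{t*}/D^W −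 (g₀(fun t ↦ D_t)·(1 − p₋) + g₁(fun t ↦ D_t)·p₋)/D^W. -/
open Filter Topology Set

/-- Fuzzy RD-DID identification of the ATT (Theorem 4, first part). `T0` (resp. `T1`)
are the nonempty sets of periods where every unit is untreated (treated); in the
fuzzy RD period `tstar`, under local conditional independence,
`μ t* (r) = μ0 t* r + p r * (μ1 t* r - μ0 t* r)`. Under the learnability
assumptions on `α₀,t*` and `α₁,t*`, the one-sided limits defining `D_{t*}` exist and
`ATT(c,t*) = D_{t*}/D^W - (g₀(D_·)(1 - p₋) + g₁(D_·)p₋)/D^W`. -/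
theorem fuzzy_rddid_att
    {T : Type*} (c : ℝ) (tstar : T) (T0 T1 : Set T)
    (h0star : tstar ∉ T0) (h1star : tstar ∉ T1)
    (hT0 : T0.Nonempty) (hT1 : T1.Nonempty)
    (μ0 μ1 μ : T → ℝ → ℝ) (p : ℝ → ℝ)
    (hobs0 : ∀ t ∈ T0, ∀ r, μ t r = μ0 t r)
    (hobs1 : ∀ t ∈ T1, ∀ r, μ t r = μ1 t r)
    (hobsstar : ∀ r, μ tstar r = μ0 tstar r + p r * (μ1 tstar r - μ0 tstar r))
    (μ0p μ0m μ1p μ1m : T → ℝ)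
    (h0p : ∀ t ∈ insert tstar T0,
      Tendsto (μ0 t) (nhdsWithin c (Ioi c)) (nhds (μ0p t)))
    (h0m : ∀ t ∈ insert tstar T0,
      Tendsto (μ0 t) (nhdsWithin c (Iio c)) (nhds (μ0m t)))
    (h1p : ∀ t ∈ insert tstar T1,
      Tendsto (μ1 t) (nhdsWithin c (Ioi c)) (nhds (μ1p t)))
    (h1m : ∀ t ∈ insert tstar T1,
      Tendsto (μ1 t) (nhdsWithin c (Iio c)) (nhds (μ1m t)))
    (pp pm : ℝ)
    (hpp : Tendsto p (nhdsWithin c (Ioi c)) (nhds pp))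
    (hpm : Tendsto p (nhdsWithin c (Iio c)) (nhds pm))
    (hDW : pp - pm ≠ 0)
    (g0 : (T0 → ℝ) → ℝ) (g1 : (T1 → ℝ) → ℝ)
    (hg0 : μ0p tstar - μ0m tstar = g0 (fun t => μ0p t.1 - μ0m t.1))
    (hg1 : μ1p tstar - μ1m tstar = g1 (fun t => μ1p t.1 - μ1m t.1))
    (Dp Dm : T → ℝ)
    (hDp : ∀ t ∈ T0 ∪ T1, Tendsto (μ t) (nhdsWithin c (Ioi c)) (nhds (Dp t)))
    (hDm : ∀ t ∈ T0 ∪ T1, Tendsto (μ t) (nhdsWithin c (Iio c)) (nhds (Dm t))) :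
    ∃ Dsp Dsm : ℝ,
      Tendsto (μ tstar) (nhdsWithin c (Ioi c)) (nhds Dsp) ∧
      Tendsto (μ tstar) (nhdsWithin c (Iio c)) (nhds Dsm) ∧
      μ1p tstar - μ0p tstar =
        (Dsp - Dsm) / (pp - pm) -
          (g0 (fun t => Dp t.1 - Dm t.1) * (1 - pm) +
            g1 (fun t => Dp t.1 - Dm t.1) * pm) / (pp - pm) := by
  have hμ0 : ∀ t ∈ T0, μ t = μ0 t := fun t ht => funext (hobs0 t ht)
  have hμ1 : ∀ t ∈ T1, μ t = μ1 t := fun t ht => funext (hobs1 t ht)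
  have hμstar : μ tstar = fun r => μ0 tstar r + p r * (μ1 tstar r - μ0 tstar r) :=
    funext hobsstar
  have hD0 : (fun t : T0 => Dp t.1 - Dm t.1) = fun t : T0 => μ0p t.1 - μ0m t.1 := by
    funext ⟨t, ht⟩
    have hp := hDp t (Or.inl ht)
    have hm := hDm t (Or.inl ht)
    rw [hμ0 t ht] at hp hm
    exact congrArg₂ _ (tendsto_nhds_unique hp (h0p t (Or.inr ht)))
      (tendsto_nhds_unique hm (h0m t (Or.inr ht)))
  have hD1 : (fun t : T1 => Dp t.1 - Dm t.1) = fun t : T1 => μ1p t.1 - μ1m t.1 := by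
    funext ⟨t, ht⟩
    have hp := hDp t (Or.inr ht)
    have hm := hDm t (Or.inr ht)
    rw [hμ1 t ht] at hp hm
    exact congrArg₂ _ (tendsto_nhds_unique hp (h1p t (Or.inr ht)))
      (tendsto_nhds_unique hm (h1m t (Or.inr ht)))
  have h0p' := h0p tstar (mem_insert _ _)
  have h0m' := h0m tstar (mem_insert _ _)
  have h1p' := h1p tstar (mem_insert _ _)
  have h1m' := h1m tstar (mem_insert _ _)
  refine ⟨_, _, hμstar ▸ h0p'.add (hpp.mul (h1p'.sub h0p')),
    hμstar ▸ h0m'.add (hpm.mul (h1m'.sub h0m')), ?_⟩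
  rw [hD0, hD1, ← hg0, ← hg1]
  field_simp
  ring
end

section
/- Fuzzy RD-DID identification of the ATU (Theorem 4, second part): Assume the one-sided limits μ_{0,t,±} exist for all t ∈ 𝒯₀ ∪ {t*}, the one-sided limits μ_{1,t,±} exist for all t ∈ 𝒯₁ ∪ {t*}, and p₊ = lim_{r→c⁺} p_{t*}(r), p₋ = lim_{r→c⁻} p_{t*}(r) exist with D^W = p₊ − p₋ ≠ 0. Suppose 𝒯₀ and 𝒯₁ are nonempty and there are functions g₀ : (𝒯₀ → ℝ) → ℝ and g₁ : (𝒯₁ → ℝ) → ℝ with α_{0,t*} = g₀(fun t ↦ α_{0,t}) and α_{1,t*} = g₁(fun t ↦ α_{1,t}). Then the one-sided limits defining D_{t*} exist, and ATU(c,t*) = D_{t*}/D^W − (g₀(fun t ↦ D_t)·(1 − p₊) + g₁(fun t ↦ D_t)·p₊)/D^W. -/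
open Filter Topology Set

/-- Fuzzy RD-DID identification of the ATU (Theorem 4, second part). `T0` (resp. `T1`)
are the nonempty sets of periods where every unit is untreated (treated); in the
fuzzy RD period `tstar`, under local conditional independence,
`μ t* (r) = μ0 t* r + p r * (μ1 t* r - μ0 t* r)`. Under the learnability
assumptions on `α₀,t*` and `α₁,t*`, the one-sided limits defining `D_{t*}` exist and
`ATU(c,t*) = D_{t*}/D^W - (g₀(D_·)(1 - p₊) + g₁(D_·)p₊)/D^W`. -/
theorem fuzzy_rddid_atu
    {T : Type*} (c : ℝ) (tstar : T) (T0 T1 : Set T)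
    (h0star : tstar ∉ T0) (h1star : tstar ∉ T1)
    (hT0 : T0.Nonempty) (hT1 : T1.Nonempty)
    (μ0 μ1 μ : T → ℝ → ℝ) (p : ℝ → ℝ)
    (hobs0 : ∀ t ∈ T0, ∀ r, μ t r = μ0 t r)
    (hobs1 : ∀ t ∈ T1, ∀ r, μ t r = μ1 t r)
    (hobsstar : ∀ r, μ tstar r = μ0 tstar r + p r * (μ1 tstar r - μ0 tstar r))
    (μ0p μ0m μ1p μ1m : T → ℝ)
    (h0p : ∀ t ∈ insert tstar T0,
      Tendsto (μ0 t) (nhdsWithin c (Ioi c)) (nhds (μ0p t)))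
    (h0m : ∀ t ∈ insert tstar T0,
      Tendsto (μ0 t) (nhdsWithin c (Iio c)) (nhds (μ0m t)))
    (h1p : ∀ t ∈ insert tstar T1,
      Tendsto (μ1 t) (nhdsWithin c (Ioi c)) (nhds (μ1p t)))
    (h1m : ∀ t ∈ insert tstar T1,
      Tendsto (μ1 t) (nhdsWithin c (Iio c)) (nhds (μ1m t)))
    (pp pm : ℝ)
    (hpp : Tendsto p (nhdsWithin c (Ioi c)) (nhds pp))
    (hpm : Tendsto p (nhdsWithin c (Iio c)) (nhds pm))
    (hDW : pp - pm ≠ 0)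
    (g0 : (T0 → ℝ) → ℝ) (g1 : (T1 → ℝ) → ℝ)
    (hg0 : μ0p tstar - μ0m tstar = g0 (fun t => μ0p t.1 - μ0m t.1))
    (hg1 : μ1p tstar - μ1m tstar = g1 (fun t => μ1p t.1 - μ1m t.1))
    (Dp Dm : T → ℝ)
    (hDp : ∀ t ∈ T0 ∪ T1, Tendsto (μ t) (nhdsWithin c (Ioi c)) (nhds (Dp t)))
    (hDm : ∀ t ∈ T0 ∪ T1, Tendsto (μ t) (nhdsWithin c (Iio c)) (nhds (Dm t))) :
    ∃ Dsp Dsm : ℝ,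
      Tendsto (μ tstar) (nhdsWithin c (Ioi c)) (nhds Dsp) ∧
      Tendsto (μ tstar) (nhdsWithin c (Iio c)) (nhds Dsm) ∧
      μ1m tstar - μ0m tstar =
        (Dsp - Dsm) / (pp - pm) -
          (g0 (fun t => Dp t.1 - Dm t.1) * (1 - pp) +
            g1 (fun t => Dp t.1 - Dm t.1) * pp) / (pp - pm) := by
  have hlim {l : Filter ℝ} {a b q : ℝ} (ha : Tendsto (μ0 tstar) l (𝓝 a))
      (hb : Tendsto (μ1 tstar) l (𝓝 b)) (hq : Tendsto p l (𝓝 q)) :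
      Tendsto (μ tstar) l (𝓝 (a + q * (b - a))) :=
    (ha.add (hq.mul (hb.sub ha))).congr fun r => (hobsstar r).symm
  have e0 : (fun t : T0 => Dp t.1 - Dm t.1) = fun t => μ0p t.1 - μ0m t.1 := by
    funext ⟨t, ht⟩
    have h : μ t = μ0 t := funext (hobs0 t ht)
    exact congrArg₂ (· - ·)
      (tendsto_nhds_unique (hDp t (.inl ht)) (h ▸ h0p t (.inr ht)))
      (tendsto_nhds_unique (hDm t (.inl ht)) (h ▸ h0m t (.inr ht)))
  have e1 : (fun t : T1 => Dp t.1 - Dm t.1) = fun t => μ1p t.1 - μ1m t.1 := by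
    funext ⟨t, ht⟩
    have h : μ t = μ1 t := funext (hobs1 t ht)
    exact congrArg₂ (· - ·)
      (tendsto_nhds_unique (hDp t (.inr ht)) (h ▸ h1p t (.inr ht)))
      (tendsto_nhds_unique (hDm t (.inr ht)) (h ▸ h1m t (.inr ht)))
  have hs0 := mem_insert tstar T0
  have hs1 := mem_insert tstar T1
  refine ⟨_, _, hlim (h0p _ hs0) (h1p _ hs1) hpp, hlim (h0m _ hs0) (h1m _ hs1) hpm, ?_⟩
  rw [e0, e1, ← hg0, ← hg1, ← sub_div, eq_div_iff hDW]
  ring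
end

section
/- Canonical fuzzy RD-DID with equal constant discontinuities (identification claim of Section 4.2): Consider two periods t = 1, 2, where in period 1 every unit is untreated, so μ₁ = μ_{0,1}, and in period 2 treatment follows a fuzzy RD with μ₂(r) = μ_{0,2}(r) + p₂(r)·(μ_{1,2}(r) − μ_{0,2}(r)). Assume all one-sided limits μ_{w,t,±} (w ∈ {0,1}, t ∈ {1,2}) and p₂,₊, p₂,₋ exist, D^W = p₂,₊ − p₂,₋ ≠ 0, and there is α ∈ ℝ with α_{0,1} = α_{1,1} = α_{0,2} = α_{1,2} = α. Then ATT(c,2) = ATU(c,2) and ATT(c,2) = (D₂ − D₁)/D^W, where D_t is the difference of the one-sided limits of the observed μ_t at c. -/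
open Filter Topology Set

/-- Canonical fuzzy RD-DID with equal constant discontinuities (Section 4.2): with
period 1 fully untreated (observed mean `μ01`) and period 2 a fuzzy RD with observed
mean `μ2 r = μ02 r + p2 r * (μ12 r - μ02 r)`, if all four potential-outcome
discontinuities equal a common `α` and `D^W ≠ 0`, then `ATT(c,2) = ATU(c,2)` and
`ATT(c,2) = (D₂ - D₁)/D^W`. -/
theorem canonical_fuzzy_rddid
    (c : ℝ) (μ01 μ11 μ02 μ12 μ2 p2 : ℝ → ℝ)
    (hobs2 : ∀ r, μ2 r = μ02 r + p2 r * (μ12 r - μ02 r))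
    (a01p a01m a11p a11m a02p a02m a12p a12m pp pm : ℝ)
    (h01p : Tendsto μ01 (nhdsWithin c (Ioi c)) (nhds a01p))
    (h01m : Tendsto μ01 (nhdsWithin c (Iio c)) (nhds a01m))
    (h11p : Tendsto μ11 (nhdsWithin c (Ioi c)) (nhds a11p))
    (h11m : Tendsto μ11 (nhdsWithin c (Iio c)) (nhds a11m))
    (h02p : Tendsto μ02 (nhdsWithin c (Ioi c)) (nhds a02p))
    (h02m : Tendsto μ02 (nhdsWithin c (Iio c)) (nhds a02m))
    (h12p : Tendsto μ12 (nhdsWithin c (Ioi c)) (nhds a12p))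
    (h12m : Tendsto μ12 (nhdsWithin c (Iio c)) (nhds a12m))
    (hpp : Tendsto p2 (nhdsWithin c (Ioi c)) (nhds pp))
    (hpm : Tendsto p2 (nhdsWithin c (Iio c)) (nhds pm))
    (hDW : pp - pm ≠ 0)
    (α : ℝ)
    (hα01 : a01p - a01m = α) (hα11 : a11p - a11m = α)
    (hα02 : a02p - a02m = α) (hα12 : a12p - a12m = α) :
    a12p - a02p = a12m - a02m ∧
    ∃ D2p D2m : ℝ,
      Tendsto μ2 (nhdsWithin c (Ioi c)) (nhds D2p) ∧
      Tendsto μ2 (nhdsWithin c (Iio c)) (nhds D2m) ∧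
      a12p - a02p = ((D2p - D2m) - (a01p - a01m)) / (pp - pm) := by
  have hτ : a12p - a02p = a12m - a02m := by linarith
  obtain rfl : μ2 = fun r => μ02 r + p2 r * (μ12 r - μ02 r) := funext hobs2
  refine ⟨hτ, _, _, h02p.add (hpp.mul (h12p.sub h02p)),
    h02m.add (hpm.mul (h12m.sub h02m)), ?_⟩
  rw [eq_div_iff hDW, ← hτ]
  linear_combination hα01 - hα02
end

section
/- Sharp RD bias decomposition with carry-over effects (Theorem C1): Assume the one-sided limits μ_{tp₀,t*,±} and μ_{tp₁,t*,±} at c exist. Then the one-sided limits of the observed conditional mean μ_{t*} at c exist and D_{t*} = ATT(c,t*) + α_{0,t*}, where ATT(c,t*) = μ_{tp₁,t*,+} − μ_{tp₀,t*,+} and α_{0,t*} = μ_{tp₀,t*,+} − μ_{tp₀,t*,−}. -/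
open Filter Topology Set

/-- Sharp RD bias decomposition with carry-over effects (Theorem C1): with the two
treatment paths `tp₁` (followed above the cutoff) and `tp₀` (followed below), the
one-sided limits of the observed conditional mean at the RD period `t*` exist and
`D_{t*} = ATT(c,t*) + α₀,t*`. -/
theorem sharp_rd_bias_carryover
    (c : ℝ) (μtp0 μtp1 μ : ℝ → ℝ)
    (hμ : ∀ r, μ r = if c ≤ r then μtp1 r else μtp0 r)
    (A0p A0m A1p A1m : ℝ)
    (h0p : Tendsto μtp0 (nhdsWithin c (Ioi c)) (nhds A0p))
    (h0m : Tendsto μtp0 (nhdsWithin c (Iio c)) (nhds A0m))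
    (h1p : Tendsto μtp1 (nhdsWithin c (Ioi c)) (nhds A1p))
    (h1m : Tendsto μtp1 (nhdsWithin c (Iio c)) (nhds A1m)) :
    ∃ μp μm : ℝ,
      Tendsto μ (nhdsWithin c (Ioi c)) (nhds μp) ∧
      Tendsto μ (nhdsWithin c (Iio c)) (nhds μm) ∧
      μp - μm = (A1p - A0p) + (A0p - A0m) := by
  refine ⟨A1p, A0m, h1p.congr' ?_, h0m.congr' ?_, by ring⟩
  · filter_upwards [self_mem_nhdsWithin] with r hr
    rw [hμ, if_pos (le_of_lt hr)]
  · filter_upwards [self_mem_nhdsWithin] with r hr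
    rw [hμ, if_neg (not_le_of_gt hr)]
end

section
/- Identification of the untreated discontinuity under no anticipation (Lemma C1): Assume for every t ∈ 𝒯₀ the one-sided limits μ_{tp₀,t,±} and μ_{tp₁,t,±} at c exist and the no-anticipation condition μ_{tp₀,t,+} = μ_{tp₁,t,+} holds (equivalently ATT(c,t) = 0). Then for every t ∈ 𝒯₀ the one-sided limits of the observed μ_t at c exist and α_{0,t} = D_t. -/
open Filter Topology Set

/-- Identification of the untreated discontinuity under no anticipation (Lemma C1):
for every period `t ∈ T0`, if the one-sided limits of the two path-specific means
exist and `μ_{tp₀,t,+} = μ_{tp₁,t,+}` (no anticipation, i.e. `ATT(c,t) = 0`), then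
the one-sided limits of the observed mean `μ t` exist and `α₀,t = D_t`. -/
theorem no_anticipation_identifies_alpha0
    {T : Type*} (c : ℝ) (T0 : Set T)
    (μtp0 μtp1 μ : T → ℝ → ℝ)
    (hobs : ∀ t, ∀ r, μ t r = if c ≤ r then μtp1 t r else μtp0 t r)
    (A0p A0m A1p A1m : T → ℝ)
    (h0p : ∀ t ∈ T0, Tendsto (μtp0 t) (nhdsWithin c (Ioi c)) (nhds (A0p t)))
    (h0m : ∀ t ∈ T0, Tendsto (μtp0 t) (nhdsWithin c (Iio c)) (nhds (A0m t)))
    (h1p : ∀ t ∈ T0, Tendsto (μtp1 t) (nhdsWithin c (Ioi c)) (nhds (A1p t)))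
    (h1m : ∀ t ∈ T0, Tendsto (μtp1 t) (nhdsWithin c (Iio c)) (nhds (A1m t)))
    (hna : ∀ t ∈ T0, A0p t = A1p t) :
    ∀ t ∈ T0, ∃ Dp Dm : ℝ,
      Tendsto (μ t) (nhdsWithin c (Ioi c)) (nhds Dp) ∧
      Tendsto (μ t) (nhdsWithin c (Iio c)) (nhds Dm) ∧
      A0p t - A0m t = Dp - Dm := by
  intro t ht
  refine ⟨A1p t, A0m t, (h1p t ht).congr' ?_, (h0m t ht).congr' ?_, by rw [hna t ht]⟩
  · filter_upwards [self_mem_nhdsWithin] with r hr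
    rw [hobs, if_pos (mem_Ioi.mp hr).le]
  · filter_upwards [self_mem_nhdsWithin] with r hr
    rw [hobs, if_neg (mem_Iio.mp hr).not_ge]
end

section
/- RD-DID identification of the ATT with carry-over effects (Theorem C2): Assume the one-sided limits μ_{tp₀,t,±} and μ_{tp₁,t,±} at c exist for every t ∈ 𝒯₀ ∪ {t*}, and the no-anticipation condition μ_{tp₀,t,+} = μ_{tp₁,t,+} holds for every t ∈ 𝒯₀. Suppose 𝒯₀ is nonempty and there is a function g₀ : (𝒯₀ → ℝ) → ℝ with α_{0,t*} = g₀(fun t ↦ α_{0,t}). Then ATT(c,t*) = D_{t*} − g₀(fun t ↦ D_t). -/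
open Filter Topology Set

/-- RD-DID identification of the ATT with carry-over effects (Theorem C2): with the
two treatment paths `tp₁` (followed above the cutoff) and `tp₀` (followed below),
observed means `μ t r = if r ≥ c then μtp1 t r else μtp0 t r` in every period,
no anticipation on `T0`, and learnability `α₀,t* = g₀(α₀,·)`, we get
`ATT(c,t*) = D_{t*} - g₀(D_·)`, where `D_t = Dp t - Dm t` is the discontinuity of
the observed conditional mean `μ t` at `c`. -/
theorem rddid_att_carryover
    {T : Type*} (c : ℝ) (tstar : T) (T0 : Set T) (htstar : tstar ∉ T0)
    (hT0 : T0.Nonempty)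
    (μtp0 μtp1 μ : T → ℝ → ℝ)
    (hobs : ∀ t, ∀ r, μ t r = if c ≤ r then μtp1 t r else μtp0 t r)
    (A0p A0m A1p A1m : T → ℝ)
    (h0p : ∀ t ∈ insert tstar T0,
      Tendsto (μtp0 t) (nhdsWithin c (Ioi c)) (nhds (A0p t)))
    (h0m : ∀ t ∈ insert tstar T0,
      Tendsto (μtp0 t) (nhdsWithin c (Iio c)) (nhds (A0m t)))
    (h1p : ∀ t ∈ insert tstar T0,
      Tendsto (μtp1 t) (nhdsWithin c (Ioi c)) (nhds (A1p t)))
    (h1m : ∀ t ∈ insert tstar T0,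
      Tendsto (μtp1 t) (nhdsWithin c (Iio c)) (nhds (A1m t)))
    (hna : ∀ t ∈ T0, A0p t = A1p t)
    (g0 : (T0 → ℝ) → ℝ)
    (hg0 : A0p tstar - A0m tstar = g0 (fun t => A0p t.1 - A0m t.1))
    (Dp Dm : T → ℝ)
    (hDp : ∀ t ∈ insert tstar T0,
      Tendsto (μ t) (nhdsWithin c (Ioi c)) (nhds (Dp t)))
    (hDm : ∀ t ∈ insert tstar T0,
      Tendsto (μ t) (nhdsWithin c (Iio c)) (nhds (Dm t))) :
    A1p tstar - A0p tstar =
      (Dp tstar - Dm tstar) - g0 (fun t => Dp t.1 - Dm t.1) := by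
  have hp : ∀ t ∈ insert tstar T0, Dp t = A1p t := fun t ht =>
    tendsto_nhds_unique_of_eventuallyEq (hDp t ht) (h1p t ht) <| by
      filter_upwards [self_mem_nhdsWithin] with r hr
      rw [hobs, if_pos (le_of_lt hr)]
  have hm : ∀ t ∈ insert tstar T0, Dm t = A0m t := fun t ht =>
    tendsto_nhds_unique_of_eventuallyEq (hDm t ht) (h0m t ht) <| by
      filter_upwards [self_mem_nhdsWithin] with r hr
      rw [hobs, if_neg (not_le_of_gt hr)]
  have hD : (fun t : T0 => Dp t.1 - Dm t.1) = fun t => A0p t.1 - A0m t.1 := by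
    funext t
    have ht := mem_insert_of_mem tstar t.2
    rw [hp t.1 ht, hm t.1 ht, hna t.1 t.2]
  rw [hD, ← hg0, hp tstar (mem_insert _ _), hm tstar (mem_insert _ _)]
  ring
end
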